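/- Assume each ℓ_j is convex, differentiable and G-Lipschitz, let 0 < r ≤ ε'/G, 0 < λ ≤ G/r, x̄ ∈ 𝒳 and x ∈ B_r(x̄) ∩ 𝒳. Draw i ∈ [M] with probability p̄_i, then j ∈ [N] with probability w_{ij} (independently of the MLMC randomness given i), and set ĝ(x) = (1/ε') M̂[γ_i(x)] (∇ℓ_j(x) + λ(x − x̄)). Then E[ĝ(x)] = ∇Γ_{ε,λ}(x), and there is an absolute constant C with E‖ĝ(x)‖² ≤ C G². -/

import Mathlib

open Real

noncomputable section

/-- Group loss `𝓛_i(x) = Σ_j w_{ij} ℓ_j(x)`. -/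
def groupLoss {d N M : ℕ} (w : Fin M → Fin N → ℝ)
    (ℓ : Fin N → EuclideanSpace ℝ (Fin d) → ℝ) (i : Fin M)
    (x : EuclideanSpace ℝ (Fin d)) : ℝ :=
  ∑ j, w i j * ℓ j x

/-- `γ̂(x,x'; s₁,…,sₙ)` evaluated on the first `n` terms of the sample sequence `s`. -/
def gammaHat {d N : ℕ} (ℓ : Fin N → EuclideanSpace ℝ (Fin d) → ℝ) (ε' lam : ℝ)
    (xbar x x' : EuclideanSpace ℝ (Fin d)) (n : ℕ) (s : ℕ → Fin N) : ℝ :=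
  ε' * Real.exp (((n : ℝ)⁻¹ * ∑ k ∈ Finset.range n, (ℓ (s k) x - ℓ (s k) x') +
      lam / 2 * ‖x - xbar‖ ^ 2) / ε')

/-- `D̂_{2m}`. -/
def dHat {d N : ℕ} (ℓ : Fin N → EuclideanSpace ℝ (Fin d) → ℝ) (ε' lam : ℝ)
    (xbar x x' : EuclideanSpace ℝ (Fin d)) (m : ℕ) (s : ℕ → Fin N) : ℝ :=
  gammaHat ℓ ε' lam xbar x x' (2 * m) s -
    (gammaHat ℓ ε' lam xbar x x' m s + gammaHat ℓ ε' lam xbar x x' m (fun k => s (m + k))) / 2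

/-- `p_j = (1 − 8^{−1/2}) 8^{−j/2}`. -/
def geomP (j : ℕ) : ℝ := (1 - (Real.sqrt 8)⁻¹) * ((Real.sqrt 8)⁻¹) ^ j

/-- MLMC estimator value at level `j`: `γ̂(x,x'; S₁) + D̂_{2^j}/p_j`, with `D̂_1 = 0`. -/
def mlmcVal {d N : ℕ} (ℓ : Fin N → EuclideanSpace ℝ (Fin d) → ℝ) (ε' lam : ℝ)
    (xbar x x' : EuclideanSpace ℝ (Fin d)) (j : ℕ) (s : ℕ → Fin N) : ℝ :=
  gammaHat ℓ ε' lam xbar x x' 1 s +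
    (if j = 0 then 0 else dHat ℓ ε' lam xbar x x' (2 ^ (j - 1)) s) / geomP j

/-- Extends a finite sample tuple to an infinite sequence. -/
def extSeq {N n : ℕ} (hn : 0 < n) (s : Fin n → Fin N) : ℕ → Fin N :=
  fun k => if h : k < n then s ⟨k, h⟩ else s ⟨0, hn⟩

/-- `j`-th term of the expectation of the scalar `f(J, S₁, S₂, …)`, `S ~ w_i` i.i.d. -/
def mlmcSummand {N M : ℕ} (w : Fin M → Fin N → ℝ) (i : Fin M)
    (ℱ : ℕ → (ℕ → Fin N) → ℝ) (j : ℕ) : ℝ :=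
  geomP j * ∑ s : Fin (2 ^ j) → Fin N,
    (∏ k, w i (s k)) * ℱ j (extSeq (Nat.two_pow_pos j) s)

/-- `j`-th term of the expectation of the vector-valued `f(J, S₁, S₂, …)`. -/
def mlmcSummandVec {d N M : ℕ} (w : Fin M → Fin N → ℝ) (i : Fin M)
    (ℱ : ℕ → (ℕ → Fin N) → EuclideanSpace ℝ (Fin d)) (j : ℕ) :
    EuclideanSpace ℝ (Fin d) :=
  geomP j • ∑ s : Fin (2 ^ j) → Fin N,
    (∏ k, w i (s k)) • ℱ j (extSeq (Nat.two_pow_pos j) s)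

def EE {N : ℕ} (q : Fin N → ℝ) (n : ℕ) (f : (Fin n → Fin N) → ℝ) : ℝ :=
  ∑ s, (∏ k, q (s k)) * f s

section EElemmas
variable {N : ℕ} {q : Fin N → ℝ}

theorem EE_add (n : ℕ) (f g : (Fin n → Fin N) → ℝ) :
    EE q n (fun s => f s + g s) = EE q n f + EE q n g := by
  simp [EE, mul_add, Finset.sum_add_distrib]

theorem EE_sub (n : ℕ) (f g : (Fin n → Fin N) → ℝ) :
    EE q n (fun s => f s - g s) = EE q n f - EE q n g := by
  simp [EE, mul_sub, Finset.sum_sub_distrib]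

theorem EE_mul (n : ℕ) (c : ℝ) (f : (Fin n → Fin N) → ℝ) :
    EE q n (fun s => c * f s) = c * EE q n f := by
  simp only [EE, Finset.mul_sum]
  exact Finset.sum_congr rfl fun s _ => by ring

theorem EE_const (hq : q ∈ stdSimplex ℝ (Fin N)) (n : ℕ) (c : ℝ) :
    EE q n (fun _ => c) = c := by
  have : ∑ s : Fin n → Fin N, ∏ k, q (s k) = (∑ a, q a) ^ n := by
    rw [Finset.sum_pow']
    simp
  simp only [EE, ← Finset.sum_mul]
  rw [this, hq.2]; simp

theorem EE_mono (hq : q ∈ stdSimplex ℝ (Fin N)) (n : ℕ) {f g : (Fin n → Fin N) → ℝ}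
    (h : ∀ s, f s ≤ g s) : EE q n f ≤ EE q n g :=
  Finset.sum_le_sum fun s _ =>
    mul_le_mul_of_nonneg_left (h s) (Finset.prod_nonneg fun k _ => hq.1 _)

theorem EE_nonneg (hq : q ∈ stdSimplex ℝ (Fin N)) (n : ℕ) {f : (Fin n → Fin N) → ℝ}
    (h : ∀ s, 0 ≤ f s) : 0 ≤ EE q n f :=
  Finset.sum_nonneg fun s _ => mul_nonneg (Finset.prod_nonneg fun k _ => hq.1 _) (h s)

theorem EE_abs (hq : q ∈ stdSimplex ℝ (Fin N)) (n : ℕ) (f : (Fin n → Fin N) → ℝ) :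
    |EE q n f| ≤ EE q n (fun s => |f s|) := by
  refine (Finset.abs_sum_le_sum_abs _ _).trans (Finset.sum_le_sum fun s _ => ?_)
  rw [abs_mul, abs_of_nonneg (Finset.prod_nonneg fun k _ => hq.1 _)]

theorem EE_sq (hq : q ∈ stdSimplex ℝ (Fin N)) (n : ℕ) (f : (Fin n → Fin N) → ℝ) :
    (EE q n f) ^ 2 ≤ EE q n (fun s => f s ^ 2) := by
  have h : 0 ≤ EE q n (fun s => (f s - EE q n f) ^ 2) := EE_nonneg hq n fun s => sq_nonneg _
  have h2 : (fun s => (f s - EE q n f) ^ 2)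
      = fun s => (f s ^ 2 - (2 * EE q n f) * f s) + (EE q n f) ^ 2 := by
    ext s; ring
  rw [h2, EE_add, EE_sub, EE_mul, EE_const hq] at h
  nlinarith

theorem EE_zero (f : (Fin 0 → Fin N) → ℝ) : EE q 0 f = f (fun k => k.elim0) := by
  simp only [EE, Finset.univ_unique, Finset.sum_singleton, Finset.univ_eq_empty,
    Finset.prod_empty, one_mul]
  congr 1

theorem EE_succ (n : ℕ) (f : (Fin (n + 1) → Fin N) → ℝ) :
    EE q (n + 1) f = ∑ a, q a * EE q n (fun s => f (Fin.cons a s)) := by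
  simp only [EE, Finset.mul_sum]
  rw [← Fintype.sum_prod_type']
  symm
  refine Fintype.sum_equiv (Fin.consEquiv (fun _ => Fin N)) _ _ ?_
  rintro ⟨a, s⟩
  simp [Fin.consEquiv, Fin.prod_univ_succ, mul_assoc]

theorem EE_append (m n : ℕ) (f : (Fin (m + n) → Fin N) → ℝ) :
    EE q (m + n) f = EE q m (fun s => EE q n (fun t => f (Fin.append s t))) := by
  simp only [EE, Finset.mul_sum]
  rw [← Fintype.sum_prod_type']
  symm
  refine Fintype.sum_equiv (Fin.appendEquiv m n) _ _ ?_
  rintro ⟨a, s⟩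
  simp [Fin.appendEquiv, Fin.prod_univ_add, mul_assoc]

theorem EE_left (hq : q ∈ stdSimplex ℝ (Fin N)) (m n : ℕ) (f : (Fin m → Fin N) → ℝ) :
    EE q (m + n) (fun s => f (fun k => s (Fin.castAdd n k))) = EE q m f := by
  rw [EE_append]
  simp [EE_const hq]

theorem EE_right (hq : q ∈ stdSimplex ℝ (Fin N)) (m n : ℕ) (f : (Fin n → Fin N) → ℝ) :
    EE q (m + n) (fun s => f (fun k => s (Fin.natAdd m k))) = EE q n f := by
  rw [EE_append]
  simp [EE_const hq]

theorem EE_moments (hq : q ∈ stdSimplex ℝ (Fin N)) (X : Fin N → ℝ) (B : ℝ)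
    (hB : ∀ a, |X a| ≤ B) (h0 : ∑ a, q a * X a = 0) (n : ℕ) :
    EE q n (fun s => ∑ k, X (s k)) = 0 ∧
    EE q n (fun s => (∑ k, X (s k)) ^ 2) ≤ n * B ^ 2 ∧
    EE q n (fun s => (∑ k, X (s k)) ^ 4) ≤ 3 * n ^ 2 * B ^ 4 := by
  have hX2 : ∑ a, q a * X a ^ 2 ≤ B ^ 2 := by
    calc _ ≤ ∑ a, q a * B ^ 2 := Finset.sum_le_sum fun a _ =>
          mul_le_mul_of_nonneg_left (sq_le_sq.2 ((hB a).trans (le_abs_self _))) (hq.1 a)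
      _ = B ^ 2 := by rw [← Finset.sum_mul, hq.2, one_mul]
  have hX20 : 0 ≤ ∑ a, q a * X a ^ 2 :=
    Finset.sum_nonneg fun a _ => mul_nonneg (hq.1 a) (sq_nonneg _)
  have hX4 : ∑ a, q a * X a ^ 4 ≤ B ^ 4 := by
    calc _ ≤ ∑ a, q a * B ^ 4 := Finset.sum_le_sum fun a _ => by
          refine mul_le_mul_of_nonneg_left ?_ (hq.1 a)
          have := pow_le_pow_left₀ (abs_nonneg _) (hB a) 4
          rwa [← abs_pow, abs_of_nonneg (by positivity)] at this
      _ = B ^ 4 := by rw [← Finset.sum_mul, hq.2, one_mul]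
  induction n with
  | zero => simp [EE_zero]
  | succ n ih =>
    obtain ⟨i1, i2, i4⟩ := ih
    set S : (Fin n → Fin N) → ℝ := fun s => ∑ k, X (s k) with hS
    have e1 : EE q (n+1) (fun s => ∑ k, X (s k)) = 0 := by
      rw [EE_succ]
      have : ∀ a, EE q n (fun s => ∑ k, X ((Fin.cons a s : Fin (n+1) → Fin N) k)) = X a := by
        intro a
        have : (fun s : Fin n → Fin N => ∑ k, X ((Fin.cons a s : Fin (n+1) → Fin N) k))
          = fun s => X a + S s := by ext s; simp [Fin.sum_univ_succ, hS]
        rw [this, EE_add, EE_const hq, i1, add_zero]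
      simp only [this, h0]
    have e2 : EE q (n+1) (fun s => (∑ k, X (s k)) ^ 2)
        = EE q n (fun s => S s ^ 2) + ∑ a, q a * X a ^ 2 := by
      rw [EE_succ]
      have : ∀ a, EE q n (fun s => (∑ k, X ((Fin.cons a s : Fin (n+1) → Fin N) k)) ^ 2)
          = X a ^ 2 + EE q n (fun s => S s ^ 2) := by
        intro a
        have : (fun s : Fin n → Fin N => (∑ k, X ((Fin.cons a s : Fin (n+1) → Fin N) k)) ^ 2)
          = fun s => (X a ^ 2 + (2 * X a) * S s) + S s ^ 2 := by
            ext s; simp only [Fin.sum_univ_succ, hS, Fin.cons_zero, Fin.cons_succ]; ring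
        rw [this, EE_add, EE_add, EE_const hq, EE_mul, i1]; ring
      simp only [this, mul_add, Finset.sum_add_distrib]
      rw [← Finset.sum_mul, hq.2]; ring
    have e4 : EE q (n+1) (fun s => (∑ k, X (s k)) ^ 4)
        = EE q n (fun s => S s ^ 4) + 6 * (∑ a, q a * X a ^ 2) * EE q n (fun s => S s ^ 2)
          + ∑ a, q a * X a ^ 4 := by
      rw [EE_succ]
      have : ∀ a, EE q n (fun s => (∑ k, X ((Fin.cons a s : Fin (n+1) → Fin N) k)) ^ 4)
          = X a ^ 4 + 6 * X a ^ 2 * EE q n (fun s => S s ^ 2)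
            + 4 * X a * EE q n (fun s => S s ^ 3) + EE q n (fun s => S s ^ 4) := by
        intro a
        have : (fun s : Fin n → Fin N => (∑ k, X ((Fin.cons a s : Fin (n+1) → Fin N) k)) ^ 4)
          = fun s => (((X a ^ 4 + (4 * X a ^ 3) * S s) + (6 * X a ^ 2) * S s ^ 2)
              + (4 * X a) * S s ^ 3) + S s ^ 4 := by
            ext s; simp only [Fin.sum_univ_succ, hS, Fin.cons_zero, Fin.cons_succ]; ring
        rw [this, EE_add, EE_add, EE_add, EE_add, EE_const hq, EE_mul, EE_mul, EE_mul, i1]; ring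
      simp only [this]
      have h : ∀ a, q a * (X a ^ 4 + 6 * X a ^ 2 * EE q n (fun s => S s ^ 2)
            + 4 * X a * EE q n (fun s => S s ^ 3) + EE q n (fun s => S s ^ 4))
          = q a * X a ^ 4 + (q a * X a ^ 2) * (6 * EE q n (fun s => S s ^ 2))
            + (q a * X a) * (4 * EE q n (fun s => S s ^ 3)) + q a * EE q n (fun s => S s ^ 4) := by
        intro a; ring
      simp only [h, Finset.sum_add_distrib, ← Finset.sum_mul, h0, hq.2]; ring
    refine ⟨e1, ?_, ?_⟩
    · rw [e2]; push_cast; linarith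
    · rw [e4]; push_cast
      have : (∑ a, q a * X a ^ 2) * EE q n (fun s => S s ^ 2) ≤ B ^ 2 * (n * B ^ 2) :=
        mul_le_mul hX2 i2 (EE_nonneg hq n fun s => sq_nonneg _) (sq_nonneg _)
      have hB4 : 0 ≤ B ^ 4 := by positivity
      nlinarith

/-- mean of the first n -/
def mn {N : ℕ} (a : Fin N → ℝ) (n : ℕ) (s : Fin n → Fin N) : ℝ := (n : ℝ)⁻¹ * ∑ k, a (s k)

theorem mn_moments (hq : q ∈ stdSimplex ℝ (Fin N)) (a : Fin N → ℝ)
    (ha : ∀ j, |a j| ≤ 1) (n : ℕ) (hn : 0 < n) :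
    EE q n (fun s => (mn a n s - ∑ j, q j * a j) ^ 2) ≤ 4 / n ∧
    EE q n (fun s => (mn a n s - ∑ j, q j * a j) ^ 4) ≤ 48 / n ^ 2 := by
  set μ := ∑ j, q j * a j with hμ
  have hμ1 : |μ| ≤ 1 := by
    calc |μ| ≤ ∑ j, |q j * a j| := Finset.abs_sum_le_sum_abs _ _
      _ ≤ ∑ j, q j := Finset.sum_le_sum fun j _ => by
          rw [abs_mul, abs_of_nonneg (hq.1 j)]
          exact mul_le_of_le_one_right (hq.1 j) (ha j)
      _ = 1 := hq.2
  have hm := EE_moments hq (fun j => a j - μ) 2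
    (fun j => (abs_sub _ _).trans (by linarith [ha j]))
    (by simp only [mul_sub, Finset.sum_sub_distrib, ← Finset.sum_mul, hq.2]; simp [hμ]) n
  have hn' : (0:ℝ) < n := by exact_mod_cast hn
  have e : ∀ s : Fin n → Fin N, mn a n s - μ = (n:ℝ)⁻¹ * ∑ k, (a (s k) - μ) := by
    intro s
    simp only [mn, Finset.sum_sub_distrib, Finset.sum_const, Finset.card_univ, Fintype.card_fin]
    simp; field_simp
  simp only [e, mul_pow]
  rw [EE_mul, EE_mul]
  constructor
  · calc _ ≤ (n:ℝ)⁻¹ ^ 2 * (n * 2 ^ 2) := mul_le_mul_of_nonneg_left hm.2.1 (by positivity)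
      _ = _ := by field_simp; norm_num
  · calc _ ≤ (n:ℝ)⁻¹ ^ 4 * (3 * n ^ 2 * 2 ^ 4) := mul_le_mul_of_nonneg_left hm.2.2 (by positivity)
      _ = _ := by field_simp; norm_num

theorem mn_le (a : Fin N → ℝ) (ha : ∀ j, |a j| ≤ 1) (n : ℕ) (s : Fin n → Fin N) :
    mn a n s ≤ 1 := by
  have : ∑ k, a (s k) ≤ n := by
    calc _ ≤ ∑ k : Fin n, (1:ℝ) := Finset.sum_le_sum fun k _ => (abs_le.1 (ha _)).2
      _ = n := by simp
  rcases Nat.eq_zero_or_pos n with h | h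
  · subst h; simp [mn]
  · have hn' : (0:ℝ) < n := by exact_mod_cast h
    rw [mn, inv_mul_le_iff₀ hn']; linarith

theorem exp_lip (b u v : ℝ) (hu : u ≤ b) (hv : v ≤ b) :
    |exp u - exp v| ≤ exp b * |u - v| := by
  wlog h : v ≤ u generalizing u v
  · rw [abs_sub_comm, abs_sub_comm u v]; exact this v u hv hu (by linarith)
  rw [abs_of_nonneg (by linarith [exp_le_exp.2 h]), abs_of_nonneg (by linarith)]
  have h1 : exp v = exp u * exp (v - u) := by rw [← exp_add]; ring_nf
  have h2 := add_one_le_exp (v - u)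
  have h3 := exp_le_exp.2 hu
  rw [h1]
  nlinarith [exp_pos u]

theorem jens (u v : ℝ) (hu : u ≤ 1) (hv : v ≤ 1) :
    |exp ((u + v) / 2) - (exp u + exp v) / 2| ≤ exp 1 / 8 * (u - v) ^ 2 := by
  have h := exp_lip (1/2) (u/2) (v/2) (by linarith) (by linarith)
  have e1 : exp ((u + v) / 2) = exp (u/2) * exp (v/2) := by rw [← exp_add]; ring_nf
  have e2 : exp u = exp (u/2) ^ 2 := by rw [sq, ← exp_add]; ring_nf
  have e3 : exp v = exp (v/2) ^ 2 := by rw [sq, ← exp_add]; ring_nf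
  have e4 : exp 1 = exp (1/2) ^ 2 := by rw [sq, ← exp_add]; ring_nf
  have e5 : exp ((u + v) / 2) - (exp u + exp v) / 2 = -((exp (u/2) - exp (v/2)) ^ 2 / 2) := by
    rw [e1, e2, e3]; ring
  rw [e5, abs_neg, abs_of_nonneg (by positivity), ← sq_abs, e4]
  have := pow_le_pow_left₀ (abs_nonneg _) h 2
  rw [mul_pow, sq_abs (u/2 - v/2)] at this
  nlinarith

/-- reduced D -/
def dd {N : ℕ} (a : Fin N → ℝ) (m : ℕ) (s : Fin (m + m) → Fin N) : ℝ :=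
  exp (mn a (m + m) s) - (exp (mn a m fun k => s (Fin.castAdd m k)) +
    exp (mn a m fun k => s (Fin.natAdd m k))) / 2

theorem mn_avg (a : Fin N → ℝ) (m : ℕ) (s : Fin (m + m) → Fin N) :
    mn a (m + m) s = ((mn a m fun k => s (Fin.castAdd m k)) +
      (mn a m fun k => s (Fin.natAdd m k))) / 2 := by
  simp only [mn, Fin.sum_univ_add]
  push_cast
  rw [← two_mul, mul_inv]; ring

theorem dd_abs (a : Fin N → ℝ) (ha : ∀ j, |a j| ≤ 1) (m : ℕ) (s : Fin (m + m) → Fin N) :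
    |dd a m s| ≤ exp 1 / 8 * ((mn a m fun k => s (Fin.castAdd m k)) -
      (mn a m fun k => s (Fin.natAdd m k))) ^ 2 := by
  rw [dd, mn_avg]
  exact jens _ _ (mn_le a ha _ _) (mn_le a ha _ _)

theorem EE_dd (hq : q ∈ stdSimplex ℝ (Fin N)) (a : Fin N → ℝ) (m : ℕ) :
    EE q (m + m) (dd a m) = EE q (m + m) (fun s => exp (mn a (m + m) s))
      - EE q m (fun s => exp (mn a m s)) := by
  have : dd a m = fun s => exp (mn a (m + m) s) -
      ((1/2) * exp (mn a m fun k => s (Fin.castAdd m k)) +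
        (1/2) * exp (mn a m fun k => s (Fin.natAdd m k))) := by
    ext s; simp only [dd]; ring
  rw [this, EE_sub, EE_add, EE_mul, EE_mul, EE_left hq m m (fun s => exp (mn a m s)),
    EE_right hq m m (fun s => exp (mn a m s))]
  ring

theorem EE_diff (hq : q ∈ stdSimplex ℝ (Fin N)) (a : Fin N → ℝ) (ha : ∀ j, |a j| ≤ 1)
    (m : ℕ) (hm : 0 < m) :
    EE q (m + m) (fun s => ((mn a m fun k => s (Fin.castAdd m k)) -
      (mn a m fun k => s (Fin.natAdd m k))) ^ 2) ≤ 16 / m ∧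
    EE q (m + m) (fun s => ((mn a m fun k => s (Fin.castAdd m k)) -
      (mn a m fun k => s (Fin.natAdd m k))) ^ 4) ≤ 768 / m ^ 2 := by
  obtain ⟨h2, h4⟩ := mn_moments hq a ha m hm
  set μ := ∑ j, q j * a j with hμ
  constructor
  · refine (EE_mono hq _ (g := fun s => 2 * ((mn a m fun k => s (Fin.castAdd m k)) - μ) ^ 2 +
      2 * ((mn a m fun k => s (Fin.natAdd m k)) - μ) ^ 2) fun s => ?_).trans ?_
    · nlinarith [sq_nonneg ((mn a m fun k => s (Fin.castAdd m k)) - μ +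
        ((mn a m fun k => s (Fin.natAdd m k)) - μ))]
    · rw [EE_add, EE_mul, EE_mul, EE_left hq m m (fun s => (mn a m s - μ) ^ 2),
        EE_right hq m m (fun s => (mn a m s - μ) ^ 2)]
      calc _ ≤ 2 * (4 / (m:ℝ)) + 2 * (4 / m) := by linarith
        _ = _ := by ring
  · refine (EE_mono hq _ (g := fun s => 8 * ((mn a m fun k => s (Fin.castAdd m k)) - μ) ^ 4 +
      8 * ((mn a m fun k => s (Fin.natAdd m k)) - μ) ^ 4) fun s => ?_).trans ?_
    · have key : ∀ p r : ℝ, (p - r) ^ 4 ≤ 8 * p ^ 4 + 8 * r ^ 4 := by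
        intro p r
        have h1 : (p - r) ^ 2 ≤ 2 * p ^ 2 + 2 * r ^ 2 := by nlinarith [sq_nonneg (p + r)]
        have h2 := pow_le_pow_left₀ (sq_nonneg _) h1 2
        nlinarith [sq_nonneg (p ^ 2 - r ^ 2)]
      have := key ((mn a m fun k => s (Fin.castAdd m k)) - μ)
        ((mn a m fun k => s (Fin.natAdd m k)) - μ)
      simpa using this
    · rw [EE_add, EE_mul, EE_mul, EE_left hq m m (fun s => (mn a m s - μ) ^ 4),
        EE_right hq m m (fun s => (mn a m s - μ) ^ 4)]
      calc _ ≤ 8 * (48 / (m:ℝ) ^ 2) + 8 * (48 / m ^ 2) := by linarith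
        _ = _ := by ring

theorem EE_dd_abs (hq : q ∈ stdSimplex ℝ (Fin N)) (a : Fin N → ℝ) (ha : ∀ j, |a j| ≤ 1)
    (m : ℕ) (hm : 0 < m) : |EE q (m + m) (dd a m)| ≤ 2 * exp 1 / m := by
  refine (EE_abs hq _ _).trans ((EE_mono hq _ (dd_abs a ha m)).trans ?_)
  rw [EE_mul]
  calc _ ≤ exp 1 / 8 * (16 / (m:ℝ)) :=
        mul_le_mul_of_nonneg_left (EE_diff hq a ha m hm).1 (by positivity)
    _ = _ := by ring

theorem EE_dd_sq (hq : q ∈ stdSimplex ℝ (Fin N)) (a : Fin N → ℝ) (ha : ∀ j, |a j| ≤ 1)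
    (m : ℕ) (hm : 0 < m) : EE q (m + m) (fun s => dd a m s ^ 2) ≤ 12 * exp 2 / m ^ 2 := by
  refine (EE_mono hq _ (g := fun s => exp 2 / 64 * ((mn a m fun k => s (Fin.castAdd m k)) -
      (mn a m fun k => s (Fin.natAdd m k))) ^ 4) fun s => ?_).trans ?_
  · have := pow_le_pow_left₀ (abs_nonneg _) (dd_abs a ha m s) 2
    rw [sq_abs] at this
    refine this.trans (le_of_eq ?_)
    have : exp 2 = exp 1 ^ 2 := by rw [sq, ← exp_add]; norm_num
    rw [this]; ring
  · rw [EE_mul]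
    calc _ ≤ exp 2 / 64 * (768 / (m:ℝ) ^ 2) :=
          mul_le_mul_of_nonneg_left (EE_diff hq a ha m hm).2 (by positivity)
      _ = _ := by ring

theorem EE_exp_tendsto (hq : q ∈ stdSimplex ℝ (Fin N)) (a : Fin N → ℝ) (ha : ∀ j, |a j| ≤ 1) :
    Filter.Tendsto (fun k : ℕ => EE q (2 ^ k) (fun s => exp (mn a (2 ^ k) s)))
      Filter.atTop (nhds (exp (∑ j, q j * a j))) := by
  set μ := ∑ j, q j * a j with hμ
  have hμ1 : μ ≤ 1 := by
    calc μ ≤ ∑ j, q j := Finset.sum_le_sum fun j _ =>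
          mul_le_of_le_one_right (hq.1 j) (abs_le.1 (ha j)).2
      _ = 1 := hq.2
  have hb : ∀ k : ℕ, (EE q (2 ^ k) (fun s => exp (mn a (2 ^ k) s)) - exp μ) ^ 2
      ≤ (exp 1 ^ 2 * 4) * (1/2) ^ k := by
    intro k
    have e : EE q (2 ^ k) (fun s => exp (mn a (2 ^ k) s)) - exp μ
        = EE q (2 ^ k) (fun s => exp (mn a (2 ^ k) s) - exp μ) := by
      rw [EE_sub, EE_const hq]
    rw [e]
    refine (EE_sq hq _ _).trans ?_
    refine (EE_mono hq _ (g := fun s => exp 1 ^ 2 * (mn a (2 ^ k) s - μ) ^ 2) fun s => ?_).trans ?_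
    · have := pow_le_pow_left₀ (abs_nonneg _) (exp_lip 1 _ μ (mn_le a ha _ s) hμ1) 2
      rwa [mul_pow, sq_abs, sq_abs] at this
    · rw [EE_mul]
      refine (mul_le_mul_of_nonneg_left (mn_moments hq a ha (2 ^ k) (by positivity)).1
        (by positivity)).trans (le_of_eq ?_)
      push_cast
      rw [one_div, inv_pow]; ring
  have h0 : Filter.Tendsto (fun k : ℕ => (exp 1 ^ 2 * 4) * ((1:ℝ)/2) ^ k) Filter.atTop (nhds 0) := by
    have := (tendsto_pow_atTop_nhds_zero_of_lt_one (by norm_num : (0:ℝ) ≤ 1/2)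
      (by norm_num)).const_mul (exp 1 ^ 2 * 4)
    rwa [mul_zero] at this
  have h1 := squeeze_zero (fun k => sq_nonneg _) hb h0
  have h2 := h1.sqrt
  simp only [Real.sqrt_sq_eq_abs, Real.sqrt_zero] at h2
  exact tendsto_sub_nhds_zero_iff.1 ((tendsto_zero_iff_abs_tendsto_zero _).2 h2)

end EElemmas

section link
variable {d N : ℕ} {q : Fin N → ℝ}

theorem EE_first (hq : q ∈ stdSimplex ℝ (Fin N)) (n : ℕ) (hn : 0 < n) (h : Fin N → ℝ) :
    EE q n (fun s => h (s ⟨0, hn⟩)) = ∑ j, q j * h j := by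
  obtain ⟨m, rfl⟩ : ∃ m, n = m + 1 := ⟨n - 1, by omega⟩
  rw [EE_succ]
  refine Finset.sum_congr rfl fun a _ => ?_
  have : (fun s : Fin m → Fin N => h ((Fin.cons a s : Fin (m+1) → Fin N) ⟨0, hn⟩))
      = fun _ => h a := by ext s; rfl
  rw [this, EE_const hq]

theorem gammaHat_eq (ℓ : Fin N → EuclideanSpace ℝ (Fin d) → ℝ) (ε' lam : ℝ)
    (xbar x : EuclideanSpace ℝ (Fin d)) (n : ℕ) (t : ℕ → Fin N) :
    gammaHat ℓ ε' lam xbar x xbar n t = ε' * (exp (lam / 2 * ‖x - xbar‖ ^ 2 / ε') *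
      exp (mn (fun j => (ℓ j x - ℓ j xbar) / ε') n (fun k => t k))) := by
  rw [gammaHat, ← exp_add, mn, Finset.sum_range, ← Finset.sum_div]
  congr 2; ring

theorem extSeq_apply {n : ℕ} (hn : 0 < n) (s : Fin n → Fin N) (k : ℕ) (h : k < n) :
    extSeq hn s k = s ⟨k, h⟩ := by simp [extSeq, h]

theorem dHat_eq (ℓ : Fin N → EuclideanSpace ℝ (Fin d) → ℝ) (ε' lam : ℝ)
    (xbar x : EuclideanSpace ℝ (Fin d)) (m : ℕ) (hn : 0 < m + m) (s : Fin (m + m) → Fin N) :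
    dHat ℓ ε' lam xbar x xbar m (extSeq hn s) = ε' * (exp (lam / 2 * ‖x - xbar‖ ^ 2 / ε') *
      dd (fun j => (ℓ j x - ℓ j xbar) / ε') m s) := by
  rw [dHat, two_mul, gammaHat_eq, gammaHat_eq, gammaHat_eq, dd]
  have h1 : (fun k : Fin (m + m) => extSeq hn s k) = s := by
    ext k; rw [extSeq_apply hn s k k.2]
  have h2 : (fun k : Fin m => extSeq hn s k) = fun k => s (Fin.castAdd m k) := by
    ext k; rw [extSeq_apply hn s k (by omega)]; rfl
  have h3 : (fun k : Fin m => extSeq hn s (m + k)) = fun k => s (Fin.natAdd m k) := by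
    ext k; rw [extSeq_apply hn s _ (by omega)]; rfl
  rw [h1, h2, h3]; ring

theorem gammaHat_one (ℓ : Fin N → EuclideanSpace ℝ (Fin d) → ℝ) (ε' lam : ℝ)
    (xbar x : EuclideanSpace ℝ (Fin d)) (n : ℕ) (hn : 0 < n) (s : Fin n → Fin N) :
    gammaHat ℓ ε' lam xbar x xbar 1 (extSeq hn s) =
      ε' * (exp (lam / 2 * ‖x - xbar‖ ^ 2 / ε') *
        exp ((fun j => (ℓ j x - ℓ j xbar) / ε') (s ⟨0, hn⟩))) := by
  rw [gammaHat_eq]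
  simp [mn, extSeq_apply hn s 0 hn]

theorem geomP_pos (k : ℕ) : 0 < geomP k := by
  have h8 : 1 < Real.sqrt 8 := by
    rw [Real.lt_sqrt] <;> norm_num
  have : (Real.sqrt 8)⁻¹ < 1 := inv_lt_one_of_one_lt₀ h8
  unfold geomP
  have : 0 < 1 - (Real.sqrt 8)⁻¹ := by linarith
  positivity

theorem geomP_hasSum : HasSum geomP 1 := by
  have h8 : 1 < Real.sqrt 8 := by
    rw [Real.lt_sqrt] <;> norm_num
  have h : (Real.sqrt 8)⁻¹ < 1 := inv_lt_one_of_one_lt₀ h8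
  have := (hasSum_geometric_of_lt_one (by positivity) h).mul_left (1 - (Real.sqrt 8)⁻¹)
  rwa [mul_inv_cancel₀ (by linarith)] at this

theorem ratio_summable : Summable (fun k : ℕ => (1/4 : ℝ) ^ k / geomP k) := by
  have h8 : Real.sqrt 8 < 4 := by
    rw [Real.sqrt_lt] <;> norm_num
  have : (fun k : ℕ => (1/4 : ℝ) ^ k / geomP k)
      = fun k => (1 - (Real.sqrt 8)⁻¹)⁻¹ * (Real.sqrt 8 / 4) ^ k := by
    ext k
    rw [geomP, div_pow, div_pow, inv_pow]
    have : (0:ℝ) < Real.sqrt 8 := by positivity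
    field_simp
    simp
  rw [this]
  exact (summable_geometric_of_lt_one (by positivity) (by linarith)).mul_left _

def bnd (k : ℕ) : ℝ :=
  exp 1 * (2 * exp 2 * geomP k + 96 * exp 2 * ((1/4 : ℝ) ^ k / geomP k))

theorem bnd_summable : Summable bnd :=
  ((geomP_hasSum.summable.mul_left _).add (ratio_summable.mul_left _)).mul_left _

theorem bnd_nonneg (k : ℕ) : 0 ≤ bnd k := by
  have := geomP_pos k
  unfold bnd; positivity

theorem two_pow_succ_add (k : ℕ) : 2 ^ (k + 1) = 2 ^ k + 2 ^ k := by ring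

/-- transport lemma -/
theorem EE_mlmc_succ (ℓ : Fin N → EuclideanSpace ℝ (Fin d) → ℝ) (ε' lam : ℝ)
    (xbar x : EuclideanSpace ℝ (Fin d)) (Φ : ℝ → ℝ) (k n : ℕ) (hn : 0 < n)
    (h : n = 2 ^ k + 2 ^ k) (he : ε' ≠ 0) :
    EE q n (fun s => Φ (ε'⁻¹ * mlmcVal ℓ ε' lam xbar x xbar (k + 1) (extSeq hn s))) =
    EE q (2 ^ k + 2 ^ k) (fun s => Φ (exp (lam / 2 * ‖x - xbar‖ ^ 2 / ε') *
      (exp ((fun j => (ℓ j x - ℓ j xbar) / ε') (s ⟨0, h ▸ hn⟩)) +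
       (geomP (k + 1))⁻¹ * dd (fun j => (ℓ j x - ℓ j xbar) / ε') (2 ^ k) s))) := by
  subst h
  congr 1
  ext s
  congr 1
  rw [mlmcVal, gammaHat_one, if_neg (by omega), Nat.add_sub_cancel, dHat_eq]
  field_simp

theorem EE_mlmc_zero (ℓ : Fin N → EuclideanSpace ℝ (Fin d) → ℝ) (ε' lam : ℝ)
    (xbar x : EuclideanSpace ℝ (Fin d)) (Φ : ℝ → ℝ) (n : ℕ) (hn : 0 < n) (he : ε' ≠ 0) :
    EE q n (fun s => Φ (ε'⁻¹ * mlmcVal ℓ ε' lam xbar x xbar 0 (extSeq hn s))) =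
    EE q n (fun s => Φ (exp (lam / 2 * ‖x - xbar‖ ^ 2 / ε') *
      exp ((fun j => (ℓ j x - ℓ j xbar) / ε') (s ⟨0, hn⟩)))) := by
  congr 1
  ext s
  congr 1
  rw [mlmcVal, gammaHat_one, if_pos rfl]
  field_simp
  simp

theorem mlmc_hasSum (hq : q ∈ stdSimplex ℝ (Fin N)) (ℓ : Fin N → EuclideanSpace ℝ (Fin d) → ℝ)
    (ε' lam : ℝ) (xbar x : EuclideanSpace ℝ (Fin d)) (he : ε' ≠ 0)
    (ha : ∀ j, |(ℓ j x - ℓ j xbar) / ε'| ≤ 1) :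
    HasSum (fun k => geomP k * EE q (2 ^ k) (fun s =>
      ε'⁻¹ * mlmcVal ℓ ε' lam xbar x xbar k (extSeq (Nat.two_pow_pos k) s)))
      (exp (lam / 2 * ‖x - xbar‖ ^ 2 / ε') * exp (∑ j, q j * ((ℓ j x - ℓ j xbar) / ε'))) := by
  set a : Fin N → ℝ := fun j => (ℓ j x - ℓ j xbar) / ε' with hadef
  set c := lam / 2 * ‖x - xbar‖ ^ 2 / ε' with hc
  set A : ℕ → ℝ := fun k => EE q (2 ^ k) (fun s => exp (mn a (2 ^ k) s)) with hA
  set A1 : ℝ := ∑ j, q j * exp (a j) with hA1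
  have hA0 : A 0 = A1 := by
    rw [hA1, ← EE_first hq 1 one_pos (fun j => exp (a j))]
    simp [hA, mn]
  set B : ℕ → ℝ := fun k => if k = 0 then 0 else A k - A (k - 1) with hBdef
  have hdd : ∀ k, EE q (2 ^ k + 2 ^ k) (dd a (2 ^ k)) = A (k + 1) - A k := by
    intro k
    rw [EE_dd hq, hA]
    simp only
    rw [two_pow_succ_add]
  have hterm : ∀ k, geomP k * EE q (2 ^ k) (fun s =>
      ε'⁻¹ * mlmcVal ℓ ε' lam xbar x xbar k (extSeq (Nat.two_pow_pos k) s))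
      = exp c * (geomP k * A1 + B k) := by
    intro k
    rcases k with _ | k
    · rw [EE_mlmc_zero (q := q) ℓ ε' lam xbar x (fun y => y) _ _ he, EE_mul,
        EE_first hq (2 ^ 0) (Nat.two_pow_pos 0) (fun j => exp (a j))]
      simp only [hBdef, if_pos]; ring
    · rw [EE_mlmc_succ (q := q) ℓ ε' lam xbar x (fun y => y) k _ _ (two_pow_succ_add k) he, EE_mul,
        EE_add, EE_mul, EE_first hq _ _ (fun j => exp (a j)), hdd]
      have hp := (geomP_pos (k + 1)).ne'
      simp only [hBdef, Nat.add_sub_cancel, if_neg (Nat.succ_ne_zero k)]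
      change geomP (k + 1) * (exp c * (A1 + (geomP (k + 1))⁻¹ * (A (k + 1) - A k))) = _
      field_simp
  have hBs : Summable B := by
    rw [← summable_nat_add_iff 1]
    refine Summable.of_norm_bounded (g := fun k : ℕ => 2 * exp 1 * (1/2 : ℝ) ^ k)
      ((summable_geometric_of_lt_one (by norm_num) (by norm_num)).mul_left _) fun k => ?_
    have := EE_dd_abs hq a ha (2 ^ k) (Nat.two_pow_pos k)
    rw [hdd] at this
    simp only [hBdef, Nat.add_sub_cancel, if_neg (Nat.succ_ne_zero k), Real.norm_eq_abs]
    refine this.trans (le_of_eq ?_)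
    push_cast
    rw [one_div, inv_pow]; ring
  have hpart : ∀ n, ∑ k ∈ Finset.range (n + 1), B k = A n - A 0 := by
    intro n
    induction n with
    | zero => simp [hBdef]
    | succ n ih =>
      rw [Finset.sum_range_succ, ih]
      simp [hBdef]
  have hBsum : HasSum B (exp (∑ j, q j * a j) - A1) := by
    rw [hBs.hasSum_iff_tendsto_nat, ← Filter.tendsto_add_atTop_iff_nat 1]
    simp only [hpart, hA0]
    exact (EE_exp_tendsto hq a ha).sub_const _
  have := ((geomP_hasSum.mul_right A1).add hBsum).mul_left (exp c)
  simp only [hterm]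
  have e : exp c * (1 * A1 + (exp (∑ j, q j * a j) - A1)) = exp c * exp (∑ j, q j * a j) := by ring
  rw [e] at this
  exact this

theorem mlmc_sq_le (hq : q ∈ stdSimplex ℝ (Fin N)) (ℓ : Fin N → EuclideanSpace ℝ (Fin d) → ℝ)
    (ε' lam : ℝ) (xbar x : EuclideanSpace ℝ (Fin d)) (he : ε' ≠ 0)
    (ha : ∀ j, |(ℓ j x - ℓ j xbar) / ε'| ≤ 1)
    (hc : lam / 2 * ‖x - xbar‖ ^ 2 / ε' ≤ 1 / 2) (k : ℕ) :
    geomP k * EE q (2 ^ k) (fun s =>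
      (ε'⁻¹ * mlmcVal ℓ ε' lam xbar x xbar k (extSeq (Nat.two_pow_pos k) s)) ^ 2) ≤ bnd k := by
  have hec : exp (lam / 2 * ‖x - xbar‖ ^ 2 / ε') ^ 2 ≤ exp 1 := by
    rw [sq, ← exp_add]; exact exp_le_exp.2 (by linarith)
  set E := exp (lam / 2 * ‖x - xbar‖ ^ 2 / ε') with hE
  set a : Fin N → ℝ := fun j => (ℓ j x - ℓ j xbar) / ε' with hadef
  have hea : ∀ j, exp (a j) ^ 2 ≤ exp 2 := by
    intro j
    rw [sq, ← exp_add]; exact exp_le_exp.2 (by linarith [(abs_le.1 (ha j)).2])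
  have hpk := geomP_pos k
  rcases k with _ | k
  · rw [EE_mlmc_zero (q := q) ℓ ε' lam xbar x (fun y => y ^ 2) _ _ he]
    have h1 : EE q (2 ^ 0) (fun s => (E * exp (a (s ⟨0, Nat.two_pow_pos 0⟩))) ^ 2)
        ≤ exp 1 * exp 2 := by
      rw [← EE_const hq (2 ^ 0) (exp 1 * exp 2)]
      refine EE_mono hq _ fun s => ?_
      rw [mul_pow]
      exact mul_le_mul hec (hea _) (by positivity) (by positivity)
    calc _ ≤ geomP 0 * (exp 1 * exp 2) := mul_le_mul_of_nonneg_left h1 hpk.le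
      _ ≤ bnd 0 := by
        unfold bnd
        have : 0 ≤ exp 1 * (96 * exp 2 * ((1/4 : ℝ) ^ 0 / geomP 0)) := by positivity
        have : 0 ≤ exp 1 * (exp 2 * geomP 0) := by positivity
        nlinarith
  · rw [EE_mlmc_succ (q := q) ℓ ε' lam xbar x (fun y => y ^ 2) k _ _ (two_pow_succ_add k) he]
    set p := geomP (k + 1) with hp
    have h1 : EE q (2 ^ k + 2 ^ k) (fun s =>
        (E * (exp (a (s ⟨0, by positivity⟩)) + p⁻¹ * dd a (2 ^ k) s)) ^ 2)
        ≤ exp 1 * (2 * exp 2 + (2 * p⁻¹ ^ 2) * (12 * exp 2 / ((2 ^ k : ℕ) : ℝ) ^ 2)) := by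
      refine (EE_mono hq _ (g := fun s => exp 1 * (2 * exp 2 + (2 * p⁻¹ ^ 2) *
        dd a (2 ^ k) s ^ 2)) fun s => ?_).trans ?_
      · rw [mul_pow]
        refine mul_le_mul hec ?_ (by positivity) (by positivity)
        have := hea (s ⟨0, by positivity⟩)
        nlinarith [sq_nonneg (exp (a (s ⟨0, by positivity⟩)) - p⁻¹ * dd a (2 ^ k) s)]
      · rw [EE_mul, EE_add, EE_const hq, EE_mul]
        have := EE_dd_sq hq a ha (2 ^ k) (Nat.two_pow_pos k)
        gcongr
    refine (mul_le_mul_of_nonneg_left h1 hpk.le).trans (le_of_eq ?_)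
    rw [bnd, ← hp]
    push_cast
    have h4 : ((1/4 : ℝ)) ^ (k + 1) = 1 / (4 * (2 ^ k) ^ 2) := by
      rw [← pow_mul, mul_comm k 2, pow_mul, pow_succ, one_div, inv_pow]; norm_num
    rw [h4]
    field_simp
    ring
end link

/-- For convex, differentiable, `G`-Lipschitz losses, `0 < r ≤ ε'/G`,
`0 < λ ≤ G/r` and `x ∈ B_r(x̄) ∩ 𝒳`, the MLMC gradient estimator
`ĝ(x) = (1/ε') M̂[γ_i(x)] (∇ℓ_j(x) + λ(x − x̄))` with `i ~ p̄`, `j ~ w_i` satisfies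
`E[ĝ(x)] = ∇Γ_{ε,λ}(x)` and `E‖ĝ(x)‖² ≤ C G²` for an absolute constant `C`. -/
theorem stmt3 :
    ∃ C : ℝ, 0 < C ∧
    ∀ (d N M : ℕ) (_ : 2 ≤ M)
      (𝒳 : Set (EuclideanSpace ℝ (Fin d))) (_ : Convex ℝ 𝒳) (_ : IsClosed 𝒳)
      (ℓ : Fin N → EuclideanSpace ℝ (Fin d) → ℝ)
      (gradℓ : Fin N → EuclideanSpace ℝ (Fin d) → EuclideanSpace ℝ (Fin d))
      (w : Fin M → Fin N → ℝ) (_ : ∀ i, w i ∈ stdSimplex ℝ (Fin N))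
      (G ε ε' lam r : ℝ) (_ : 0 < G) (_ : 0 < ε)
      (_ : ε' = ε / (2 * Real.log (M : ℝ)))
      (_ : ∀ j, ConvexOn ℝ 𝒳 (ℓ j))
      (_ : ∀ j z, HasGradientAt (ℓ j) (gradℓ j z) z)
      (_ : ∀ j (z z' : EuclideanSpace ℝ (Fin d)), |ℓ j z - ℓ j z'| ≤ G * ‖z - z'‖)
      (_ : 0 < r) (_ : r ≤ ε' / G) (_ : 0 < lam) (_ : lam ≤ G / r)
      (xbar : EuclideanSpace ℝ (Fin d)) (_ : xbar ∈ 𝒳)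
      (x : EuclideanSpace ℝ (Fin d)) (_ : x ∈ Metric.closedBall xbar r ∩ 𝒳),
      let pbar : Fin M → ℝ := fun i =>
        Real.exp (groupLoss w ℓ i xbar / ε') / ∑ k, Real.exp (groupLoss w ℓ k xbar / ε')
      let gvec : Fin N → ℕ → (ℕ → Fin N) → EuclideanSpace ℝ (Fin d) := fun j k s =>
        (ε'⁻¹ * mlmcVal ℓ ε' lam xbar x xbar k s) • (gradℓ j x + lam • (x - xbar))
      (∀ i j, Summable (mlmcSummandVec w i (gvec j))) ∧
      HasGradientAt
        (fun z => ∑ i, pbar i *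
          (ε' * Real.exp ((groupLoss w ℓ i z - groupLoss w ℓ i xbar +
            lam / 2 * ‖z - xbar‖ ^ 2) / ε')))
        (∑ i, pbar i • ∑ j, w i j • ∑' k, mlmcSummandVec w i (gvec j) k) x ∧
      (∀ i j, Summable (mlmcSummand w i (fun k s => ‖gvec j k s‖ ^ 2))) ∧
      (∑ i, pbar i * ∑ j, w i j * ∑' k, mlmcSummand w i (fun k s => ‖gvec j k s‖ ^ 2) k)
        ≤ C * G ^ 2 := by
  refine ⟨4 * ∑' k, bnd k + 1, by
    have : 0 ≤ ∑' k, bnd k := tsum_nonneg bnd_nonneg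
    linarith, ?_⟩
  intro d N M hM 𝒳 _ _ ℓ gradℓ w hw G ε ε' lam r hG hε _ _ hgrad hlip hr hrε hlam hlamr xbar _ x hx
  intro pbar gvec
  have he : 0 < ε' := by
    have h1 : 0 < ε' / G := lt_of_lt_of_le hr hrε
    by_contra h
    exact absurd h1 (not_lt.2 (div_nonpos_of_nonpos_of_nonneg (not_lt.1 h) hG.le))
  have hxr : ‖x - xbar‖ ≤ r := by
    have := hx.1
    rwa [Metric.mem_closedBall, dist_eq_norm] at this
  have hGr : G * r ≤ ε' := by rw [le_div_iff₀ hG] at hrε; linarith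
  have hlr : lam * r ≤ G := by rwa [le_div_iff₀ hr] at hlamr
  have ha : ∀ j, |(ℓ j x - ℓ j xbar) / ε'| ≤ 1 := by
    intro j
    rw [abs_div, abs_of_pos he, div_le_one he]
    exact (hlip j x xbar).trans ((mul_le_mul_of_nonneg_left hxr hG.le).trans hGr)
  have hc : lam / 2 * ‖x - xbar‖ ^ 2 / ε' ≤ 1 / 2 := by
    rw [div_le_iff₀ he]
    have h1 : lam * ‖x - xbar‖ ^ 2 ≤ lam * r ^ 2 :=
      mul_le_mul_of_nonneg_left (pow_le_pow_left₀ (norm_nonneg _) hxr 2) hlam.le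
    nlinarith
  have hv : ∀ j, ‖gradℓ j x + lam • (x - xbar)‖ ^ 2 ≤ 4 * G ^ 2 := by
    intro j
    have h1 : ‖gradℓ j x‖ ≤ G := by
      have hl : LipschitzWith ⟨G, hG.le⟩ (ℓ j) :=
        LipschitzWith.of_dist_le_mul fun y z => by
          rw [Real.dist_eq, dist_eq_norm]; exact hlip j y z
      have := (hgrad j x).hasFDerivAt.le_of_lipschitz hl
      rwa [LinearIsometryEquiv.norm_map] at this
    have h2 : ‖lam • (x - xbar)‖ ≤ G := by
      rw [norm_smul, Real.norm_eq_abs, abs_of_pos hlam]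
      exact (mul_le_mul_of_nonneg_left hxr hlam.le).trans hlr
    have h3 := (norm_add_le (gradℓ j x) (lam • (x - xbar)))
    nlinarith [norm_nonneg (gradℓ j x + lam • (x - xbar))]
  have hvec : ∀ i j k, mlmcSummandVec w i (gvec j) k =
      (geomP k * EE (w i) (2 ^ k) (fun s =>
        ε'⁻¹ * mlmcVal ℓ ε' lam xbar x xbar k (extSeq (Nat.two_pow_pos k) s))) •
      (gradℓ j x + lam • (x - xbar)) := by
    intro i j k
    simp only [mlmcSummandVec, gvec, EE, smul_smul, ← Finset.sum_smul]
  have hsc : ∀ i j k, mlmcSummand w i (fun k s => ‖gvec j k s‖ ^ 2) k =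
      (geomP k * EE (w i) (2 ^ k) (fun s =>
        (ε'⁻¹ * mlmcVal ℓ ε' lam xbar x xbar k (extSeq (Nat.two_pow_pos k) s)) ^ 2)) *
      ‖gradℓ j x + lam • (x - xbar)‖ ^ 2 := by
    intro i j k
    simp only [mlmcSummand, gvec, EE, norm_smul, mul_pow, Real.norm_eq_abs, sq_abs,
      ← mul_assoc, ← Finset.sum_mul]
  have hsum : ∀ i j, HasSum (mlmcSummandVec w i (gvec j))
      ((exp (lam / 2 * ‖x - xbar‖ ^ 2 / ε') *
        exp (∑ j, w i j * ((ℓ j x - ℓ j xbar) / ε'))) • (gradℓ j x + lam • (x - xbar))) := by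
    intro i j
    rw [funext (hvec i j)]
    exact (mlmc_hasSum (hw i) ℓ ε' lam xbar x he.ne' ha).smul_const _
  have hT : ∀ i k, 0 ≤ geomP k * EE (w i) (2 ^ k) (fun s =>
        (ε'⁻¹ * mlmcVal ℓ ε' lam xbar x xbar k (extSeq (Nat.two_pow_pos k) s)) ^ 2) :=
    fun i k => mul_nonneg (geomP_pos k).le (EE_nonneg (hw i) _ fun s => sq_nonneg _)
  have hle : ∀ i j k, mlmcSummand w i (fun k s => ‖gvec j k s‖ ^ 2) k ≤ bnd k * (4 * G ^ 2) := by
    intro i j k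
    rw [hsc]
    exact mul_le_mul (mlmc_sq_le (hw i) ℓ ε' lam xbar x he.ne' ha hc k) (hv j) (sq_nonneg _)
      (bnd_nonneg k)
  have hsm : ∀ i j, Summable (mlmcSummand w i (fun k s => ‖gvec j k s‖ ^ 2)) := by
    intro i j
    refine Summable.of_nonneg_of_le (fun k => ?_) (hle i j) (bnd_summable.mul_right _)
    rw [hsc]; exact mul_nonneg (hT i k) (sq_nonneg _)
  have hS : 0 < ∑ k, Real.exp (groupLoss w ℓ k xbar / ε') :=
    Finset.sum_pos (fun _ _ => exp_pos _) ⟨⟨0, by omega⟩, Finset.mem_univ _⟩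
  have hp0 : ∀ i, 0 ≤ pbar i := fun i => div_nonneg (exp_pos _).le hS.le
  have hp1 : ∑ i, pbar i = 1 := by
    simp only [pbar, ← Finset.sum_div]; exact div_self hS.ne'
  refine ⟨fun i j => (hsum i j).summable, ?_, hsm, ?_⟩
  · simp only [fun i j => (hsum i j).tsum_eq]
    have hL : ∀ i, HasGradientAt (fun z => groupLoss w ℓ i z - groupLoss w ℓ i xbar +
        lam / 2 * ‖z - xbar‖ ^ 2) (∑ j, w i j • (gradℓ j x + lam • (x - xbar))) x := by
      intro i
      rw [hasGradientAt_iff_hasFDerivAt]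
      have h1 : HasFDerivAt (fun z => groupLoss w ℓ i z) (∑ j, w i j •
          (InnerProductSpace.toDual ℝ (EuclideanSpace ℝ (Fin d)) (gradℓ j x))) x := by
        unfold groupLoss
        exact HasFDerivAt.fun_sum fun j _ => (hgrad j x).hasFDerivAt.const_mul (w i j)
      have h2 : HasFDerivAt (fun z => ‖z - xbar‖ ^ 2) _ x :=
        ((hasFDerivAt_id x).sub_const xbar).norm_sq
      refine ((h1.sub_const (groupLoss w ℓ i xbar)).add (h2.const_mul (lam / 2))).congr_fderiv ?_
      ext y
      simp [smul_add, Finset.sum_add_distrib, ← Finset.sum_smul, (hw i).2, inner_add_left,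
        inner_smul_left, sum_inner]
      ring
    rw [hasGradientAt_iff_hasFDerivAt]
    have hfin : HasFDerivAt (fun z => ∑ i, pbar i *
          (ε' * Real.exp ((groupLoss w ℓ i z - groupLoss w ℓ i xbar +
            lam / 2 * ‖z - xbar‖ ^ 2) / ε'))) _ x :=
      HasFDerivAt.fun_sum fun i _ =>
        ((((hL i).hasFDerivAt.mul_const ε'⁻¹).exp).const_mul ε').const_mul (pbar i)
    refine hfin.congr_fderiv ?_
    rw [map_sum]
    refine Finset.sum_congr rfl fun i _ => ?_
    have hexp : exp (lam / 2 * ‖x - xbar‖ ^ 2 / ε') *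
        exp (∑ j, w i j * ((ℓ j x - ℓ j xbar) / ε')) =
        exp ((groupLoss w ℓ i x - groupLoss w ℓ i xbar + lam / 2 * ‖x - xbar‖ ^ 2) * ε'⁻¹) := by
      rw [← exp_add]
      congr 1
      have : ∑ j, w i j * ((ℓ j x - ℓ j xbar) / ε') =
          (groupLoss w ℓ i x - groupLoss w ℓ i xbar) / ε' := by
        simp only [groupLoss, ← Finset.sum_sub_distrib, Finset.sum_div]
        exact Finset.sum_congr rfl fun j _ => by ring
      rw [this]; ring
    rw [hexp]
    have hcomm : ∑ j, w i j • exp ((groupLoss w ℓ i x - groupLoss w ℓ i xbar +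
          lam / 2 * ‖x - xbar‖ ^ 2) * ε'⁻¹) • (gradℓ j x + lam • (x - xbar)) =
        exp ((groupLoss w ℓ i x - groupLoss w ℓ i xbar +
          lam / 2 * ‖x - xbar‖ ^ 2) * ε'⁻¹) • ∑ j, w i j • (gradℓ j x + lam • (x - xbar)) := by
      rw [Finset.smul_sum]
      exact Finset.sum_congr rfl fun j _ => smul_comm _ _ _
    rw [hcomm]
    generalize ∑ j, w i j • (gradℓ j x + lam • (x - xbar)) = V
    ext y
    simp [inner_smul_left]
    field_simp
    exact Or.inl trivial
  · have ht : ∀ i j, ∑' k, mlmcSummand w i (fun k s => ‖gvec j k s‖ ^ 2) k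
        ≤ (∑' k, bnd k) * (4 * G ^ 2) := by
      intro i j
      rw [← tsum_mul_right]
      exact (hsm i j).tsum_le_tsum (hle i j) (bnd_summable.mul_right _)
    calc _ ≤ ∑ i, pbar i * ∑ j, w i j * ((∑' k, bnd k) * (4 * G ^ 2)) := by
          refine Finset.sum_le_sum fun i _ => mul_le_mul_of_nonneg_left ?_ (hp0 i)
          exact Finset.sum_le_sum fun j _ => mul_le_mul_of_nonneg_left (ht i j) ((hw i).1 j)
      _ = (∑' k, bnd k) * (4 * G ^ 2) := by
          simp only [← Finset.sum_mul, (hw _).2, hp1, one_mul]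
      _ ≤ _ := by nlinarith [sq_nonneg G]
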